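/- For every positive integer n, the number of distinct values taken by τ(G), as G ranges over all finite simple graphs on n vertices, is at least 2^{n/2 - 1}. -/

import Mathlib

/-- The number of spanning trees of a finite simple graph `G`: the number of
subgraphs `T ≤ G` (on the same vertex set) that are trees. -/
noncomputable def numSpanningTrees {V : Type} [Fintype V] (G : SimpleGraph V) : ℕ :=
  Set.ncard {T : SimpleGraph V | T ≤ G ∧ T.IsTree}

open SimpleGraph

section AddVertex

variable {V : Type}

/-- The graph obtained from `F` by adding a new vertex `none` with neighbourhood `S`. -/
def addVertex (F : SimpleGraph V) (S : Set V) : SimpleGraph (Option V) where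
  Adj
    | none, none => False
    | none, some a => a ∈ S
    | some a, none => a ∈ S
    | some a, some b => F.Adj a b
  symm := ⟨by
    rintro (_ | a) (_ | b) h
    exacts [h, h, h, F.adj_symm h]⟩
  loopless := ⟨by
    rintro (_ | a) h
    exacts [h, F.loopless.irrefl a h]⟩

@[simp] lemma addVertex_adj_none_none (F : SimpleGraph V) (S : Set V) :
    (addVertex F S).Adj none none ↔ False := Iff.rfl

@[simp] lemma addVertex_adj_none_some (F : SimpleGraph V) (S : Set V) (a : V) :
    (addVertex F S).Adj none (some a) ↔ a ∈ S := Iff.rfl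

@[simp] lemma addVertex_adj_some_none (F : SimpleGraph V) (S : Set V) (a : V) :
    (addVertex F S).Adj (some a) none ↔ a ∈ S := Iff.rfl

@[simp] lemma addVertex_adj_some_some (F : SimpleGraph V) (S : Set V) (a b : V) :
    (addVertex F S).Adj (some a) (some b) ↔ F.Adj a b := Iff.rfl

lemma addVertex_le_addVertex {F G : SimpleGraph V} {S S' : Set V} :
    addVertex F S ≤ addVertex G S' ↔ F ≤ G ∧ S ⊆ S' := by
  constructor
  · exact fun h => ⟨fun a b hab => @h (some a) (some b) hab, fun a ha => @h none (some a) ha⟩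
  · rintro ⟨h₁, h₂⟩ (_ | a) (_ | b) h
    exacts [h, h₂ h, h₂ h, h₁ h]

lemma addVertex_inj {F G : SimpleGraph V} {S S' : Set V} :
    addVertex F S = addVertex G S' ↔ F = G ∧ S = S' := by
  refine ⟨fun h => ?_, by rintro ⟨rfl, rfl⟩; rfl⟩
  have h₁ := addVertex_le_addVertex.1 h.le
  have h₂ := addVertex_le_addVertex.1 h.ge
  exact ⟨le_antisymm h₁.1 h₂.1, Set.Subset.antisymm h₁.2 h₂.2⟩

lemma addVertex_left_injective (S : Set V) : Function.Injective (addVertex · S) :=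
  fun _ _ h => (addVertex_inj.1 h).1

lemma exists_eq_addVertex (T : SimpleGraph (Option V)) : ∃ F S, T = addVertex F S := by
  refine ⟨T.comap some, {a | T.Adj none (some a)}, ?_⟩
  ext (_ | a) (_ | b) <;> simp [T.adj_comm (some _) none]

lemma not_connected_addVertex_empty [Nonempty V] (F : SimpleGraph V) :
    ¬ (addVertex F ∅).Connected := by
  intro h
  obtain ⟨a⟩ := ‹Nonempty V›
  obtain ⟨w⟩ := h.preconnected none (some a)
  rcases w with _ | @⟨_, _ | b, _, hb, _⟩
  exacts [hb, hb]

lemma SimpleGraph.Reachable.of_adj_reachable {W : Type} {G : SimpleGraph V} {H : SimpleGraph W} (f : V → W)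
    (h : ∀ a b, G.Adj a b → H.Reachable (f a) (f b)) {a b : V} (hab : G.Reachable a b) :
    H.Reachable (f a) (f b) := by
  obtain ⟨w⟩ := hab
  induction w with
  | nil => rfl
  | cons hadj _ ih => exact (h _ _ hadj).trans ih

lemma connected_addVertex_pair_iff (F : SimpleGraph V) (s t : V) :
    (addVertex F {s, t}).Connected ↔ (F ⊔ edge s t).Connected := by
  constructor
  · intro h
    have hst : (F ⊔ edge s t).Reachable t s := by
      by_cases hst : t = s
      · rw [hst]
      · exact Adj.reachable (Or.inr (by simp [edge_adj, hst]))
    have key : ∀ x y, (addVertex F {s, t}).Adj x y →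
        (F ⊔ edge s t).Reachable (x.getD t) (y.getD t) := by
      rintro (_ | a) (_ | b) hab
      · exact hab.elim
      · obtain rfl | rfl := hab
        exacts [hst, Reachable.rfl]
      · obtain rfl | rfl := hab
        exacts [hst.symm, Reachable.rfl]
      · exact Adj.reachable (Or.inl hab)
    exact { preconnected := fun a b =>
              Reachable.of_adj_reachable _ key (h.preconnected (some a) (some b))
            nonempty := ⟨t⟩ }
  · intro h
    have hs : (addVertex F {s, t}).Reachable none (some s) := Adj.reachable (Or.inl rfl)
    have ht : (addVertex F {s, t}).Reachable none (some t) := Adj.reachable (Or.inr rfl)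
    have key : ∀ a b, (F ⊔ edge s t).Adj a b →
        (addVertex F {s, t}).Reachable (some a) (some b) := by
      rintro a b (hab | hab)
      · exact Adj.reachable hab
      · rw [edge_adj] at hab
        obtain ⟨⟨rfl, rfl⟩ | ⟨rfl, rfl⟩, -⟩ := hab
        exacts [hs.symm.trans ht, ht.symm.trans hs]
    have hnone : ∀ x, (addVertex F {s, t}).Reachable none x := by
      rintro (_ | a)
      · rfl
      · exact ht.trans (Reachable.of_adj_reachable _ key (h.preconnected t a))
    exact { preconnected := fun x y => (hnone x).symm.trans (hnone y)
            nonempty := ⟨none⟩ }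

lemma edgeSet_addVertex (F : SimpleGraph V) (S : Set V) :
    (addVertex F S).edgeSet =
      Sym2.map some '' F.edgeSet ∪ (fun a => s(none, some a)) '' S := by
  ext e
  induction e with
  | h x y =>
    rw [mem_edgeSet]
    constructor
    · intro h
      rcases x with _ | a <;> rcases y with _ | b
      · exact h.elim
      · exact Or.inr ⟨b, h, rfl⟩
      · exact Or.inr ⟨a, h, Sym2.eq_swap⟩
      · exact Or.inl ⟨s(a, b), h, rfl⟩
    · rintro (⟨e, he, h⟩ | ⟨a, ha, h⟩)
      · induction e with
        | h a b =>
          rw [← mem_edgeSet, ← h]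
          exact he
      · rw [← mem_edgeSet, ← h]
        exact ha

lemma card_edgeSet_addVertex [Finite V] (F : SimpleGraph V) (S : Set V) :
    Nat.card (addVertex F S).edgeSet = Nat.card F.edgeSet + S.ncard := by
  rw [Nat.card_coe_set_eq, Nat.card_coe_set_eq, edgeSet_addVertex, Set.ncard_union_eq,
    Set.ncard_image_of_injective _ (Sym2.map.injective (Option.some_injective V)),
    Set.ncard_image_of_injective]
  · intro a b h
    simpa using h
  · rw [Set.disjoint_left]
    rintro _ ⟨e, -, rfl⟩ ⟨a, -, h⟩
    induction e with
    | h x y => simp at h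

lemma isTree_addVertex_singleton_iff [Finite V] (F : SimpleGraph V) (t : V) :
    (addVertex F {t}).IsTree ↔ F.IsTree := by
  have h := connected_addVertex_pair_iff F t t
  rw [Set.pair_eq_singleton, sup_edge_self] at h
  rw [isTree_iff_connected_and_card, isTree_iff_connected_and_card, h, card_edgeSet_addVertex,
    Set.ncard_singleton, Finite.card_option]
  simp

lemma card_edgeSet_sup_edge [Finite V] (F : SimpleGraph V) {s t : V} (hst : s ≠ t)
    (h : ¬ F.Adj s t) : Nat.card (F ⊔ edge s t).edgeSet = Nat.card F.edgeSet + 1 := by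
  rw [Nat.card_coe_set_eq, Nat.card_coe_set_eq, edgeSet_sup, edgeSet_edge_of_ne hst,
    Set.union_singleton, Set.ncard_insert_of_notMem (by simpa using h)]

lemma isTree_addVertex_pair_iff [Finite V] (F : SimpleGraph V) {s t : V} (hst : s ≠ t) :
    (addVertex F {s, t}).IsTree ↔ ¬ F.Adj s t ∧ (F ⊔ edge s t).IsTree := by
  rw [isTree_iff_connected_and_card, isTree_iff_connected_and_card,
    connected_addVertex_pair_iff, card_edgeSet_addVertex, Set.ncard_pair hst,
    Finite.card_option]
  by_cases h : F.Adj s t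
  · simp only [h, not_true_eq_false, false_and, iff_false, sup_edge_of_adj]
    rintro ⟨h₁, h₂⟩
    have := h₁.card_vert_le_card_edgeSet_add_one
    omega
  · rw [card_edgeSet_sup_edge F hst h]
    simp only [h, not_false_eq_true, true_and, Nat.add_right_cancel_iff]

end AddVertex

section Counting

variable {V : Type}

/-- The number of spanning forests of `G` that become spanning trees when the edge joining `s`
and `t` is added to them. -/
noncomputable def numSplitForests (G : SimpleGraph V) (s t : V) : ℕ :=
  Set.ncard {F : SimpleGraph V | F ≤ G ∧ ¬ F.Adj s t ∧ (F ⊔ edge s t).IsTree}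

lemma numSpanningTrees_sup_edge [Fintype V] (G : SimpleGraph V) {s t : V} (hst : s ≠ t) (h : ¬ G.Adj s t) :
    numSpanningTrees (G ⊔ edge s t) = numSpanningTrees G + numSplitForests G s t := by
  have hset : {T | T ≤ G ⊔ edge s t ∧ T.IsTree} = {T | T ≤ G ∧ T.IsTree} ∪
      (· ⊔ edge s t) '' {F | F ≤ G ∧ ¬ F.Adj s t ∧ (F ⊔ edge s t).IsTree} := by
    ext T
    constructor
    · rintro ⟨hle, hT⟩
      by_cases hadj : T.Adj s t
      · have hT' : T \ edge s t ⊔ edge s t = T :=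
          sdiff_sup_cancel ((edge_le_iff T).2 (Or.inr hadj))
        refine Or.inr ⟨T \ edge s t, ⟨sdiff_le_iff'.2 hle, ?_, ?_⟩, hT'⟩
        · simp [edge_adj, hst]
        · rwa [hT']
      · refine Or.inl ⟨fun a b hab => ?_, hT⟩
        obtain h' | h' := hle hab
        · exact h'
        · rw [edge_adj] at h'
          obtain ⟨⟨rfl, rfl⟩ | ⟨rfl, rfl⟩, -⟩ := h'
          exacts [(hadj hab).elim, (hadj hab.symm).elim]
    · rintro (⟨hle, hT⟩ | ⟨F, ⟨hle, -, hT⟩, rfl⟩)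
      exacts [⟨hle.trans le_sup_left, hT⟩, ⟨sup_le_sup_right hle _, hT⟩]
  rw [numSpanningTrees, hset, Set.ncard_union_eq, Set.InjOn.ncard_image]
  · rfl
  · rintro F ⟨-, hF, -⟩ F' ⟨-, hF', -⟩ hFF
    rw [← disjoint_edge] at hF hF'
    rw [← hF.sup_sdiff_cancel_right, ← hF'.sup_sdiff_cancel_right]
    exact congrArg (· \ edge s t) hFF
  · rw [Set.disjoint_left]
    rintro _ ⟨hle, -⟩ ⟨F, -, rfl⟩
    exact h (hle (Or.inr (by simp [edge_adj, hst])))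

lemma numSplitForests_sup_edge (G : SimpleGraph V) (s t : V) :
    numSplitForests (G ⊔ edge s t) s t = numSplitForests G s t := by
  rw [numSplitForests, numSplitForests]
  congr 1
  ext F
  refine ⟨fun ⟨hle, hF, hT⟩ => ⟨fun a b hab => ?_, hF, hT⟩,
    fun ⟨hle, hF, hT⟩ => ⟨hle.trans le_sup_left, hF, hT⟩⟩
  obtain h | h := hle hab
  · exact h
  · rw [edge_adj] at h
    obtain ⟨⟨rfl, rfl⟩ | ⟨rfl, rfl⟩, -⟩ := h
    exacts [(hF hab).elim, (hF hab.symm).elim]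

lemma numSpanningTrees_addVertex_singleton [Fintype V] (G : SimpleGraph V) (t : V) :
    numSpanningTrees (addVertex G {t}) = numSpanningTrees G := by
  have : Nonempty V := ⟨t⟩
  have hset : {T | T ≤ addVertex G {t} ∧ T.IsTree} =
      (addVertex · {t}) '' {T | T ≤ G ∧ T.IsTree} := by
    ext T
    constructor
    · rintro ⟨hle, hT⟩
      obtain ⟨F, S, rfl⟩ := exists_eq_addVertex T
      rw [addVertex_le_addVertex] at hle
      obtain rfl | rfl := Set.subset_singleton_iff_eq.1 hle.2
      · exact (not_connected_addVertex_empty F hT.connected).elim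
      · exact ⟨F, ⟨hle.1, (isTree_addVertex_singleton_iff F t).1 hT⟩, rfl⟩
    · rintro ⟨F, ⟨hle, hT⟩, rfl⟩
      exact ⟨addVertex_le_addVertex.2 ⟨hle, le_rfl⟩, (isTree_addVertex_singleton_iff F t).2 hT⟩
  rw [numSpanningTrees, hset, Set.ncard_image_of_injective _ (addVertex_left_injective _),
    numSpanningTrees]

lemma numSpanningTrees_addVertex_pair [Fintype V] (G : SimpleGraph V) {s t : V} (hst : s ≠ t) :
    numSpanningTrees (addVertex G {s, t}) =
      2 * numSpanningTrees G + numSplitForests G s t := by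
  have : Nonempty V := ⟨t⟩
  have hset : {T | T ≤ addVertex G {s, t} ∧ T.IsTree} =
      ((addVertex · {s}) '' {T | T ≤ G ∧ T.IsTree} ∪
        (addVertex · {t}) '' {T | T ≤ G ∧ T.IsTree}) ∪
      (addVertex · {s, t}) '' {F | F ≤ G ∧ ¬ F.Adj s t ∧ (F ⊔ edge s t).IsTree} := by
    ext T
    constructor
    · rintro ⟨hle, hT⟩
      obtain ⟨F, S, rfl⟩ := exists_eq_addVertex T
      rw [addVertex_le_addVertex] at hle
      obtain rfl | rfl | rfl | rfl := Set.subset_pair_iff_eq.1 hle.2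
      · exact (not_connected_addVertex_empty F hT.connected).elim
      · exact Or.inl (Or.inl ⟨F, ⟨hle.1, (isTree_addVertex_singleton_iff F _).1 hT⟩, rfl⟩)
      · exact Or.inl (Or.inr ⟨F, ⟨hle.1, (isTree_addVertex_singleton_iff F _).1 hT⟩, rfl⟩)
      · exact Or.inr ⟨F, ⟨hle.1, (isTree_addVertex_pair_iff F hst).1 hT⟩, rfl⟩
    · rintro ((⟨F, ⟨hle, hT⟩, rfl⟩ | ⟨F, ⟨hle, hT⟩, rfl⟩) | ⟨F, ⟨hle, hT⟩, rfl⟩)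
      · exact ⟨addVertex_le_addVertex.2 ⟨hle, by simp⟩,
          (isTree_addVertex_singleton_iff F _).2 hT⟩
      · exact ⟨addVertex_le_addVertex.2 ⟨hle, by simp⟩,
          (isTree_addVertex_singleton_iff F _).2 hT⟩
      · exact ⟨addVertex_le_addVertex.2 ⟨hle, le_rfl⟩, (isTree_addVertex_pair_iff F hst).2 hT⟩
  have hdisj : ∀ {S S' : Set V} (A B : Set (SimpleGraph V)), S ≠ S' →
      Disjoint ((addVertex · S) '' A) ((addVertex · S') '' B) := by
    intro S S' A B hS
    rw [Set.disjoint_left]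
    rintro _ ⟨F, -, rfl⟩ ⟨F', -, h⟩
    exact hS (addVertex_inj.1 h).2.symm
  have hs : ({s} : Set V) ≠ {s, t} := fun h =>
    hst (h.symm.subset (Set.mem_insert_of_mem s rfl) : t ∈ ({s} : Set V)).symm
  have ht : ({t} : Set V) ≠ {s, t} := fun h =>
    hst (h.symm.subset (Set.mem_insert s {t}) : s ∈ ({t} : Set V))
  rw [numSpanningTrees, hset, Set.ncard_union_eq
      (Set.disjoint_union_left.2 ⟨hdisj _ _ hs, hdisj _ _ ht⟩),
    Set.ncard_union_eq (hdisj _ _ (by simpa using hst)),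
    Set.ncard_image_of_injective _ (addVertex_left_injective _),
    Set.ncard_image_of_injective _ (addVertex_left_injective _),
    Set.ncard_image_of_injective _ (addVertex_left_injective _), ← two_mul]
  rfl

lemma addVertex_singleton_sup_edge (G : SimpleGraph V) (s t : V) :
    addVertex G {t} ⊔ edge (some s) none = addVertex G {s, t} := by
  ext (_ | a) (_ | b) <;> simp [edge_adj, or_comm]

lemma numSplitForests_addVertex_singleton [Fintype V] (G : SimpleGraph V) {s t : V} (hst : s ≠ t) :
    numSplitForests (addVertex G {t}) (some s) none =
      numSpanningTrees G + numSplitForests G s t := by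
  have h := numSpanningTrees_sup_edge (addVertex G {t}) (Option.some_ne_none s)
    (by simpa using hst)
  rw [addVertex_singleton_sup_edge, numSpanningTrees_addVertex_pair G hst,
    numSpanningTrees_addVertex_singleton] at h
  omega

lemma numSpanningTrees_congr {W : Type} [Fintype V] [Fintype W] {G : SimpleGraph V} {H : SimpleGraph W}
    (e : G ≃g H) : numSpanningTrees G = numSpanningTrees H := by
  refine Set.ncard_congr (fun T _ => T.map e.toEquiv.toEmbedding) ?_ ?_ ?_
  · rintro T ⟨hle, hT⟩
    refine ⟨?_, (Iso.map e.toEquiv T).isTree_iff.1 hT⟩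
    rw [map_le_iff_le_comap]
    exact fun a b hab => e.map_adj_iff.2 (hle hab)
  · exact fun T T' _ _ h => map_injective _ h
  · rintro T ⟨hle, hT⟩
    refine ⟨T.comap e, ⟨fun a b hab => e.map_adj_iff.1 (hle hab), ?_⟩, ?_⟩
    · exact (Iso.comap e.toEquiv T).isTree_iff.2 hT
    · ext a b
      obtain ⟨a, rfl⟩ := e.surjective a
      obtain ⟨b, rfl⟩ := e.surjective b
      exact map_adj_apply (f := e.toEquiv.toEmbedding)

end Counting

/-- `(a, b)` counts the spanning trees and the split forests of some graph on `n` vertices with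
respect to two distinct non-adjacent vertices. -/
def IsTreeForestPair (n a b : ℕ) : Prop :=
  ∃ (V : Type) (_ : Fintype V) (G : SimpleGraph V) (s t : V), Fintype.card V = n ∧ s ≠ t ∧
    ¬ G.Adj s t ∧ numSpanningTrees G = a ∧ numSplitForests G s t = b

namespace IsTreeForestPair

lemma two_zero_one : IsTreeForestPair 2 0 1 := by
  refine ⟨Bool, inferInstance, ⊥, false, true, rfl, by simp, by simp, ?_, ?_⟩
  · rw [numSpanningTrees, Set.ncard_eq_zero, Set.eq_empty_iff_forall_notMem]
    rintro T ⟨hT, h⟩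
    obtain rfl := le_bot_iff.1 hT
    have := h.connected.card_vert_le_card_edgeSet_add_one
    simp at this
  · rw [numSplitForests, Set.ncard_eq_one]
    refine ⟨⊥, Set.eq_singleton_iff_unique_mem.2 ⟨⟨le_rfl, by simp, ?_⟩,
      fun F hF => le_bot_iff.1 hF.1⟩⟩
    rw [isTree_iff_connected_and_card, card_edgeSet_sup_edge _ (by simp) (by simp)]
    refine ⟨?_, by simp⟩
    have h : (⊥ ⊔ edge false true : SimpleGraph Bool) = ⊤ := by
      ext a b
      cases a <;> cases b <;> simp [edge_adj]
    rw [h]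
    exact connected_top

lemma series {n a b : ℕ} (h : IsTreeForestPair n a b) : IsTreeForestPair (n + 1) a (a + b) := by
  obtain ⟨V, _, G, s, t, hV, hst, -, rfl, rfl⟩ := h
  exact ⟨Option V, inferInstance, addVertex G {t}, some s, none, by simp [hV], by simp,
    by simpa using hst, numSpanningTrees_addVertex_singleton G t,
    numSplitForests_addVertex_singleton G hst⟩

lemma parallel_series {n a b : ℕ} (h : IsTreeForestPair n a b) :
    IsTreeForestPair (n + 1) (a + b) (a + b + b) := by
  obtain ⟨V, _, G, s, t, hV, hst, hadj, rfl, rfl⟩ := h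
  refine ⟨Option V, inferInstance, addVertex (G ⊔ edge s t) {t}, some s, none, by simp [hV],
    by simp, by simpa using hst, ?_, ?_⟩
  · rw [numSpanningTrees_addVertex_singleton, numSpanningTrees_sup_edge G hst hadj]
  · rw [numSplitForests_addVertex_singleton _ hst, numSpanningTrees_sup_edge G hst hadj,
      numSplitForests_sup_edge]

end IsTreeForestPair

/-- The values taken by the number of spanning trees of a graph on `n` vertices. -/
def treeSpectrum (n : ℕ) : Set ℕ := {k | ∃ G : SimpleGraph (Fin n), numSpanningTrees G = k}

lemma treeSpectrum_finite (n : ℕ) : (treeSpectrum n).Finite :=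
  Set.finite_range fun G : SimpleGraph (Fin n) => numSpanningTrees G

lemma numSpanningTrees_mem_treeSpectrum {V : Type} [Fintype V] (G : SimpleGraph V) :
    numSpanningTrees G ∈ treeSpectrum (Fintype.card V) :=
  ⟨G.map (Fintype.equivFin V).toEmbedding,
    (numSpanningTrees_congr (Iso.map (Fintype.equivFin V) G)).symm⟩

lemma IsTreeForestPair.mem_treeSpectrum {n a b : ℕ} (h : IsTreeForestPair n a b) :
    a ∈ treeSpectrum n ∧ a + b ∈ treeSpectrum n := by
  obtain ⟨V, _, G, s, t, rfl, hst, hadj, rfl, rfl⟩ := h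
  refine ⟨numSpanningTrees_mem_treeSpectrum G, ?_⟩
  rw [← numSpanningTrees_sup_edge G hst hadj]
  exact numSpanningTrees_mem_treeSpectrum _

lemma exists_finset_isTreeForestPair (k : ℕ) : ∃ P : Finset (ℕ × ℕ), P.card = 2 ^ k ∧
    ∀ p ∈ P, p.1 < p.2 ∧ IsTreeForestPair (k + 2) p.1 p.2 := by
  induction k with
  | zero => exact ⟨{(0, 1)}, by simp, by simpa using IsTreeForestPair.two_zero_one⟩
  | succ k ih =>
    obtain ⟨P, hcard, hP⟩ := ih
    refine ⟨P.image (fun p => (p.1, p.1 + p.2)) ∪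
      P.image (fun p => (p.1 + p.2, p.1 + p.2 + p.2)), ?_, ?_⟩
    · rw [Finset.card_union_of_disjoint, Finset.card_image_of_injective,
        Finset.card_image_of_injective, hcard, pow_succ, mul_two]
      · rintro ⟨a, b⟩ ⟨c, d⟩ h
        simp only [Prod.mk.injEq] at h ⊢
        omega
      · rintro ⟨a, b⟩ ⟨c, d⟩ h
        simp only [Prod.mk.injEq] at h ⊢
        omega
      · rw [Finset.disjoint_left]
        intro x hx hx'
        obtain ⟨⟨a, b⟩, hp, rfl⟩ := Finset.mem_image.1 hx
        obtain ⟨⟨c, d⟩, -, h⟩ := Finset.mem_image.1 hx'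
        have := (hP _ hp).1
        simp only [Prod.mk.injEq] at h this
        omega
    · intro x hx
      obtain hx | hx := Finset.mem_union.1 hx
      · obtain ⟨p, hp, rfl⟩ := Finset.mem_image.1 hx
        obtain ⟨hlt, h⟩ := hP p hp
        exact ⟨by dsimp only; omega, h.series⟩
      · obtain ⟨p, hp, rfl⟩ := Finset.mem_image.1 hx
        obtain ⟨hlt, h⟩ := hP p hp
        exact ⟨by dsimp only; omega, h.parallel_series⟩

lemma two_pow_le_sq_ncard_treeSpectrum (k : ℕ) : 2 ^ k ≤ (treeSpectrum (k + 2)).ncard ^ 2 := by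
  obtain ⟨P, hcard, hP⟩ := exists_finset_isTreeForestPair k
  rw [← hcard, ← Set.ncard_coe_finset, sq, ← Set.ncard_prod]
  refine Set.ncard_le_ncard_of_injOn (fun p => (p.1, p.1 + p.2))
    (fun p hp => (hP p hp).2.mem_treeSpectrum) ?_
    ((treeSpectrum_finite _).prod (treeSpectrum_finite _))
  rintro ⟨a, b⟩ - ⟨c, d⟩ - h
  simp only [Prod.mk.injEq] at h ⊢
  omega

/-- For every positive integer `n`, the number of distinct values taken by `τ(G)` over
simple graphs `G` on `n` vertices is at least `2^(n/2 - 1)`. -/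
theorem tree_spectrum_ge_two_pow :
    ∀ n : ℕ, 0 < n →
      (2 : ℝ) ^ ((n : ℝ) / 2 - 1) ≤
        (Set.ncard {k : ℕ | ∃ G : SimpleGraph (Fin n), numSpanningTrees G = k} : ℝ) := by
  intro n hn
  change _ ≤ ((treeSpectrum n).ncard : ℝ)
  obtain rfl | ⟨k, rfl⟩ : n = 1 ∨ ∃ k, n = k + 2 := by
    obtain h | h := (Nat.succ_le_of_lt hn).eq_or_lt
    exacts [Or.inl h.symm, Or.inr ⟨n - 2, by omega⟩]
  · have h : 1 ≤ (treeSpectrum 1).ncard :=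
      (Set.ncard_pos (treeSpectrum_finite 1)).2 ⟨_, ⊥, rfl⟩
    calc (2 : ℝ) ^ (((1 : ℕ) : ℝ) / 2 - 1) ≤ 1 :=
          Real.rpow_le_one_of_one_le_of_nonpos one_le_two (by norm_num)
      _ ≤ _ := by exact_mod_cast h
  · refine le_of_sq_le_sq ?_ (Nat.cast_nonneg _)
    calc ((2 : ℝ) ^ (((k + 2 : ℕ) : ℝ) / 2 - 1)) ^ 2 = 2 ^ k := by
          rw [← Real.rpow_mul_natCast zero_le_two, ← Real.rpow_natCast]
          congr 1
          push_cast
          ring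
      _ ≤ _ := by exact_mod_cast two_pow_le_sq_ncard_treeSpectrum k
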